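/- Let R be a commutative ring, δ : R → R a derivation, v ∈ R, and D an N×N matrix over R with D·D = v·1. If X is an N×N matrix with D·X = X·D (an even cocycle of the endomorphism complex), then δ(v)·X = D·(D^δ·X) + (D^δ·X)·D. If instead D·X + X·D = 0 (an odd cocycle), then δ(v)·X = D·(D^δ·X) − (D^δ·X)·D. In particular, multiplication by δ(v) acts trivially on the cohomology of the endomorphism complex of a matrix factorization of v. -/

import Mathlib

/-- The Leibniz rule for the entrywise application of a derivation to a product of matrices. -/
theorem Matrix.map_mul_of_leibniz {l m n R : Type*} [Fintype m] [CommRing R] (δ : R → R)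
    (hadd : ∀ a b : R, δ (a + b) = δ a + δ b)
    (hmul : ∀ a b : R, δ (a * b) = δ a * b + a * δ b)
    (A : Matrix l m R) (B : Matrix m n R) :
    (A * B).map δ = A.map δ * B + A * B.map δ := by
  ext i j
  have hsum : δ (∑ k, A i k * B k j) = ∑ k, δ (A i k * B k j) :=
    map_sum (AddMonoidHom.mk' δ hadd) _ _
  simp [Matrix.mul_apply, hsum, hmul, Finset.sum_add_distrib]

/-- An additive map sends the scalar matrix of `v` entrywise to that of `δ v`. -/
theorem Matrix.map_smul_one_of_additive {n R : Type*} [DecidableEq n] [CommRing R] (δ : R → R)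
    (hadd : ∀ a b : R, δ (a + b) = δ a + δ b) (v : R) :
    (v • (1 : Matrix n n R)).map δ = δ v • (1 : Matrix n n R) := by
  have h0 : δ 0 = 0 := map_zero (AddMonoidHom.mk' δ hadd)
  ext i j
  by_cases h : i = j <;> simp [h, h0]

/-- Multiplication by `δ(v)` is nullhomotopic on the endomorphism complex of a
matrix factorization `D` of `v`: on an even cocycle `X` (i.e. `D·X = X·D`) one
has `δ(v)·X = D·(D^δ·X) + (D^δ·X)·D`, and on an odd cocycle `X`
(i.e. `D·X + X·D = 0`) one has `δ(v)·X = D·(D^δ·X) − (D^δ·X)·D`. -/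
theorem matrix_factorization_delta_v_nullhomotopic
    {R : Type*} [CommRing R] (δ : R → R)
    (hadd : ∀ a b : R, δ (a + b) = δ a + δ b)
    (hmul : ∀ a b : R, δ (a * b) = δ a * b + a * δ b)
    {N : ℕ} (v : R) (D : Matrix (Fin N) (Fin N) R)
    (hD : D * D = v • (1 : Matrix (Fin N) (Fin N) R)) :
    (∀ X : Matrix (Fin N) (Fin N) R, D * X = X * D →
      δ v • X = D * (D.map δ * X) + (D.map δ * X) * D) ∧
    (∀ X : Matrix (Fin N) (Fin N) R, D * X + X * D = 0 →
      δ v • X = D * (D.map δ * X) - (D.map δ * X) * D) := by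
  have key : D.map δ * D + D * D.map δ = δ v • (1 : Matrix (Fin N) (Fin N) R) := by
    rw [← Matrix.map_mul_of_leibniz δ hadd hmul, hD, Matrix.map_smul_one_of_additive δ hadd]
  have smul_eq (X : Matrix (Fin N) (Fin N) R) :
      δ v • X = D * (D.map δ * X) + D.map δ * (D * X) := by
    rw [← one_mul X, ← smul_mul_assoc, ← key, one_mul]
    noncomm_ring
  refine ⟨fun X hX => ?_, fun X hX => ?_⟩
  · rw [smul_eq, hX, mul_assoc (D.map δ)]
  · rw [smul_eq, eq_neg_of_add_eq_zero_left hX, mul_neg, mul_assoc (D.map δ), sub_eq_add_neg]
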